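/- arXiv:1408.1231 — 3 statements merged into one kernel-verified Lean document; each statement's English description precedes it below -/
import Mathlib

section
/- The dyadic inverse monoid Ad₂ is a Foulis monoid satisfying the lattice condition, and the map sending the J-class of an idempotent 1_U (U a clopen subset of {a,b}^ω) to its Bernoulli measure μ(U) is an isomorphism of MV-algebras from Ad₂/J onto the MV-algebra of dyadic rationals in the unit interval [0,1]. Hence the MV-algebra of dyadic rationals in [0,1] is co-ordinatized by the dyadic inverse monoid. -/
namespace Coordinatization

/-- The data of a monoid with zero equipped with an inverse operation. -/
structure InvMonData (S : Type) where
  mul : S → S → S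
  one : S
  zero : S
  inv : S → S

variable {S T : Type}

/-- `M` is an inverse monoid with zero: a monoid with zero in which every element `a`
has a unique generalized inverse `a⁻¹`. -/
structure IsInverseMonoid (M : InvMonData S) : Prop where
  mul_assoc : ∀ a b c, M.mul (M.mul a b) c = M.mul a (M.mul b c)
  one_mul : ∀ a, M.mul M.one a = a
  mul_one : ∀ a, M.mul a M.one = a
  zero_mul : ∀ a, M.mul M.zero a = M.zero
  mul_zero : ∀ a, M.mul a M.zero = M.zero
  inv_law₁ : ∀ a, M.mul (M.mul a (M.inv a)) a = a
  inv_law₂ : ∀ a, M.mul (M.mul (M.inv a) a) (M.inv a) = M.inv a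
  inv_unique : ∀ a b, M.mul (M.mul a b) a = a → M.mul (M.mul b a) b = b → b = M.inv a

/-- `e` is an idempotent. -/
def IsIdem (M : InvMonData S) (e : S) : Prop := M.mul e e = e

/-- The natural partial order: `a ≤ b` iff `a = b·e` for some idempotent `e`. -/
def nle (M : InvMonData S) (a b : S) : Prop := ∃ e, IsIdem M e ∧ a = M.mul b e

/-- `a` and `b` are compatible: `a⁻¹b` and `ab⁻¹` are both idempotents. -/
def Compatible (M : InvMonData S) (a b : S) : Prop :=
  IsIdem M (M.mul (M.inv a) b) ∧ IsIdem M (M.mul a (M.inv b))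

/-- `a` and `b` are orthogonal: `a⁻¹b = 0 = ab⁻¹`. -/
def Orthogonal (M : InvMonData S) (a b : S) : Prop :=
  M.mul (M.inv a) b = M.zero ∧ M.mul a (M.inv b) = M.zero

/-- `j` is the join of `a` and `b` with respect to the natural partial order. -/
def IsJoin (M : InvMonData S) (a b j : S) : Prop :=
  nle M a j ∧ nle M b j ∧ ∀ c, nle M a c → nle M b c → nle M j c

/-- `m` is the meet of `a` and `b` with respect to the natural partial order. -/
def IsMeet (M : InvMonData S) (a b m : S) : Prop :=
  nle M m a ∧ nle M m b ∧ ∀ c, nle M c a → nle M c b → nle M c m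

/-- Green's relation `D`: `e D f` iff there is `a` with `a⁻¹a = e` and `aa⁻¹ = f`. -/
def DRel (M : InvMonData S) (e f : S) : Prop :=
  ∃ a, M.mul (M.inv a) a = e ∧ M.mul a (M.inv a) = f

/-- `f` is a Boolean complement of the idempotent `e` in the Boolean algebra of
idempotents: `e·f = 0` and `e ∨ f = 1`. -/
def IsComplPair (M : InvMonData S) (e f : S) : Prop :=
  IsIdem M e ∧ IsIdem M f ∧ M.mul e f = M.zero ∧ IsJoin M e f M.one

/-- A Boolean inverse monoid: an inverse monoid with zero in which the idempotents form a
Boolean algebra under the natural partial order (meets of idempotents are given by products;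
complements exist), all compatible binary joins exist, and multiplication distributes over
binary joins. -/
structure IsBooleanInverseMonoid (M : InvMonData S) : Prop where
  invMon : IsInverseMonoid M
  joins_exist : ∀ a b, Compatible M a b → ∃ j, IsJoin M a b j
  mul_join_left : ∀ c a b j, IsJoin M a b j → IsJoin M (M.mul c a) (M.mul c b) (M.mul c j)
  mul_join_right : ∀ c a b j, IsJoin M a b j → IsJoin M (M.mul a c) (M.mul b c) (M.mul j c)
  compl_exists : ∀ e, IsIdem M e → ∃ f, IsComplPair M e f

/-- The relation `D` preserves complementation: `e D f` implies `ē D f̄`. -/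
def DPreservesCompl (M : InvMonData S) : Prop :=
  ∀ e f e' f', DRel M e f → IsComplPair M e e' → IsComplPair M f f' → DRel M e' f'

/-- `M` is completely semisimple: `e D f ≤ e` implies `e = f` for idempotents. -/
def CompletelySemisimple (M : InvMonData S) : Prop :=
  ∀ e f, IsIdem M e → IsIdem M f → DRel M e f → nle M f e → e = f

/-- A Foulis monoid: a completely semisimple Boolean inverse monoid in which `D`
preserves complementation. -/
def IsFoulis (M : InvMonData S) : Prop :=
  IsBooleanInverseMonoid M ∧ CompletelySemisimple M ∧ DPreservesCompl M

/-- The preorder underlying `S/J`: `Jle s t` iff `SsS ⊆ StS`, i.e. `s = a·t·b` for some `a, b`. -/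
def Jle (M : InvMonData S) (s t : S) : Prop := ∃ a b, s = M.mul (M.mul a t) b

/-- `S/J`, the poset of principal ideals, is a lattice. -/
def LatticeCondition (M : InvMonData S) : Prop :=
  ∀ s t : S,
    (∃ m, Jle M m s ∧ Jle M m t ∧ ∀ c, Jle M c s → Jle M c t → Jle M c m) ∧
    (∃ j, Jle M s j ∧ Jle M t j ∧ ∀ c, Jle M s c → Jle M t c → Jle M j c)

/-- `[e] ⊕ [f] = [g]` in `E(S)/D`: there are orthogonal idempotents `e' D e` and `f' D f`
whose join is `D`-related to `g`. -/
def OplusEq (M : InvMonData S) (e f g : S) : Prop :=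
  ∃ e' f' j, IsIdem M e' ∧ IsIdem M f' ∧ DRel M e e' ∧ DRel M f f' ∧
    M.mul e' f' = M.zero ∧ IsJoin M e' f' j ∧ DRel M j g

/-- `M` is fundamental: only idempotents commute with every idempotent. -/
def Fundamental (M : InvMonData S) : Prop :=
  ∀ s, (∀ e, IsIdem M e → M.mul s e = M.mul e s) → IsIdem M s

/-- `M` is factorizable: every element lies beneath a unit. -/
def Factorizable (M : InvMonData S) : Prop :=
  ∀ s, ∃ g, M.mul g (M.inv g) = M.one ∧ M.mul (M.inv g) g = M.one ∧ nle M s g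

/-- All binary meets exist (`∧`-monoid). -/
def HasMeets (M : InvMonData S) : Prop := ∀ a b, ∃ m, IsMeet M a b m

/-- A morphism of Boolean inverse `∧`-monoids: a monoid homomorphism mapping zero to zero,
preserving binary compatible joins and binary meets. -/
def IsMorphism (M : InvMonData S) (N : InvMonData T) (f : S → T) : Prop :=
  f M.one = N.one ∧ f M.zero = N.zero ∧
  (∀ a b, f (M.mul a b) = N.mul (f a) (f b)) ∧
  (∀ a b j, Compatible M a b → IsJoin M a b j → IsJoin N (f a) (f b) (f j)) ∧
  (∀ a b m, IsMeet M a b m → IsMeet N (f a) (f b) (f m))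

end Coordinatization
namespace Coordinatization

/-- The data of a partial algebra: a partially defined binary operation (encoded via
`Option`) together with constants `0` and `1`. -/
structure PartialAlg (E : Type) where
  add : E → E → Option E
  zero : E
  one : E

/-- The induced order: `a ≤ b` iff `b = a ⊕ c` for some `c`. -/
def PartialAlg.le {E : Type} (P : PartialAlg E) (a b : E) : Prop := ∃ c, P.add a c = some b

/-- An effect algebra: `⊕` is commutative and associative (as a partial operation),
`a ⊕ 1` is defined iff `a = 0`, and every element has a unique complement. -/
structure IsEffectAlgebra {E : Type} (P : PartialAlg E) : Prop where
  comm : ∀ a b, P.add a b = P.add b a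
  assoc : ∀ a b c, (P.add a b).bind (fun x => P.add x c) = (P.add b c).bind (fun y => P.add a y)
  one_def : ∀ a, (P.add a P.one).isSome ↔ a = P.zero
  compl : ∀ a, ∃! a', P.add a a' = some P.one

/-- The refinement property. -/
def HasRefinement {E : Type} (P : PartialAlg E) : Prop :=
  ∀ a₁ a₂ b₁ b₂ v, P.add a₁ a₂ = some v → P.add b₁ b₂ = some v →
    ∃ c₁₁ c₁₂ c₂₁ c₂₂, P.add c₁₁ c₁₂ = some a₁ ∧ P.add c₂₁ c₂₂ = some a₂ ∧
      P.add c₁₁ c₂₁ = some b₁ ∧ P.add c₁₂ c₂₂ = some b₂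

/-- The induced order is a lattice. -/
def LatticeOrdered {E : Type} (P : PartialAlg E) : Prop :=
  ∀ a b : E,
    (∃ m, P.le m a ∧ P.le m b ∧ ∀ c, P.le c a → P.le c b → P.le c m) ∧
    (∃ j, P.le a j ∧ P.le b j ∧ ∀ c, P.le a c → P.le b c → P.le j c)

/-- An MV-algebra: a lattice-ordered effect algebra with the refinement property. -/
def IsMV {E : Type} (P : PartialAlg E) : Prop :=
  IsEffectAlgebra P ∧ LatticeOrdered P ∧ HasRefinement P

/-- The MV-algebra `P` is co-ordinatized by the inverse monoid `M`: the map `φ` induces a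
bijection between `E(S)/D = S/J` and `E` carrying `[0]` to `0`, `[1]` to `1`, the partial
operation `⊕` on `D`-classes to the partial operation of `P`, and Boolean complementation
of `D`-classes to complementation in `P`; i.e. `S/J ≅ P` as MV-algebras. -/
def MVCoordinatizes {S E : Type} (M : InvMonData S) (P : PartialAlg E) : Prop :=
  ∃ φ : S → E,
    (∀ e f, IsIdem M e → IsIdem M f → (φ e = φ f ↔ DRel M e f)) ∧
    (∀ x : E, ∃ e, IsIdem M e ∧ φ e = x) ∧
    φ M.zero = P.zero ∧ φ M.one = P.one ∧
    (∀ e f z, IsIdem M e → IsIdem M f →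
      (P.add (φ e) (φ f) = some z ↔ ∃ g, IsIdem M g ∧ OplusEq M e f g ∧ φ g = z)) ∧
    (∀ e e', IsComplPair M e e' → P.add (φ e) (φ e') = some P.one)

end Coordinatization
namespace Coordinatization

/-- The infinite word obtained by prepending the finite word `l` to the infinite word `w`. -/
def app {A : Type} (l : List A) (w : ℕ → A) : ℕ → A :=
  fun k => if h : k < l.length then l.get ⟨k, h⟩ else w (k - l.length)

/-- The cylinder `xA^ω`: the set of infinite words having the finite word `x` as a prefix. -/
def cyl {A : Type} (x : List A) : Set (ℕ → A) := {w | ∃ u, w = app x u}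

/-- `XA^ω` for a finite set `X` of finite words. -/
def cylU {A : Type} (X : Finset (List A)) : Set (ℕ → A) := ⋃ x ∈ X, cyl x

/-- A (finite) prefix code: no element is a proper prefix of another. -/
def IsPrefixCode {A : Type} (X : Finset (List A)) : Prop :=
  ∀ x ∈ X, ∀ y ∈ X, x <+: y → x = y

/-- A maximal prefix code: a prefix code not properly contained in any other prefix code. -/
def IsMaximalPrefixCode {A : Type} (X : Finset (List A)) : Prop :=
  IsPrefixCode X ∧ ∀ Y : Finset (List A), IsPrefixCode Y → X ⊆ Y → X = Y

/-- The weight of a prefix code: the sum of the lengths of its words. -/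
def weight {A : Type} (X : Finset (List A)) : ℕ := ∑ x ∈ X, x.length

end Coordinatization
namespace Coordinatization

/-- A rational is dyadic if it has the form `a / 2^b`. -/
def IsDyadic (q : ℚ) : Prop := ∃ (a b : ℕ), q = (a : ℚ) / 2 ^ b

lemma IsDyadic.add {p q : ℚ} (hp : IsDyadic p) (hq : IsDyadic q) : IsDyadic (p + q) := by
  obtain ⟨a, b, rfl⟩ := hp
  obtain ⟨c, d, rfl⟩ := hq
  refine ⟨a * 2 ^ d + c * 2 ^ b, b + d, ?_⟩
  have hb : (2 : ℚ) ^ b ≠ 0 := by positivity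
  have hd : (2 : ℚ) ^ d ≠ 0 := by positivity
  push_cast
  rw [div_add_div _ _ hb hd, pow_add]
  ring

/-- The dyadic rationals in the unit interval `[0, 1]`. -/
def DyadicUnit : Type := {q : ℚ // 0 ≤ q ∧ q ≤ 1 ∧ IsDyadic q}

/-- The MV-algebra of dyadic rationals in `[0, 1]`: `x ⊕ y = x + y` when `x + y ≤ 1`
(undefined otherwise), with constants `0` and `1`. -/
noncomputable def dyadicAlg : PartialAlg DyadicUnit where
  add x y :=
    if h : x.1 + y.1 ≤ 1 then
      some ⟨x.1 + y.1, add_nonneg x.2.1 y.2.1, h, x.2.2.2.add y.2.2.2⟩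
    else none
  zero := ⟨0, le_refl 0, by norm_num, 0, 0, by norm_num⟩
  one := ⟨1, by norm_num, le_refl 1, 1, 0, by norm_num⟩

open Classical in
/-- The partial identity map on a subset `U` of the Cantor space. -/
noncomputable def pidC (U : Set (ℕ → Bool)) : PEquiv (ℕ → Bool) (ℕ → Bool) where
  toFun w := if w ∈ U then some w else none
  invFun w := if w ∈ U then some w else none
  inv a b := by
    by_cases ha : a ∈ U <;> by_cases hb : b ∈ U <;>
      simp_all [Option.mem_def, eq_comm] <;> aesop

/-- The set of partial bijections of the Cantor space `{a,b}^ω` making up the dyadic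
inverse monoid `Ad₂`: those of the form `xᵢw ↦ yᵢw` where `{x₁, …, x_r}` and
`{y₁, …, y_r}` are prefix codes with `|xᵢ| = |yᵢ|` for each `i`. -/
def Ad2Set : Set (PEquiv (ℕ → Bool) (ℕ → Bool)) :=
  {f | ∃ (r : ℕ) (x y : Fin r → List Bool),
    (∀ i j, x i <+: x j → i = j) ∧
    (∀ i j, y i <+: y j → i = j) ∧
    (∀ i, (x i).length = (y i).length) ∧
    (∀ w w', f w = some w' ↔ ∃ (i : Fin r) (u : ℕ → Bool),
      w = app (x i) u ∧ w' = app (y i) u)}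

section Splice

/-- The word agreeing with `w` before position `n` and with `u` from position `n` on. -/
def splice (n : ℕ) (w u : ℕ → Bool) : ℕ → Bool := fun k => if k < n then w k else u k

/-- The constant word `aaa…`. -/
def zeroWord : ℕ → Bool := fun _ => false

/-- The words all of whose letters from position `n` on are `a`. -/
def words (n : ℕ) : Set (ℕ → Bool) := {w | ∀ k, n ≤ k → w k = false}

lemma splice_self (n : ℕ) (w : ℕ → Bool) : splice n w w = w := by
  funext k; simp [splice]

lemma splice_splice_left (n : ℕ) (w u v : ℕ → Bool) :
    splice n (splice n w u) v = splice n w v := by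
  funext k; by_cases h : k < n <;> simp [splice, h]

lemma splice_zeroWord_mem (n : ℕ) (w : ℕ → Bool) : splice n w zeroWord ∈ words n := by
  intro k hk; simp [splice, zeroWord, Nat.not_lt.2 hk]

lemma splice_zeroWord_of_mem {n : ℕ} {w : ℕ → Bool} (hw : w ∈ words n) :
    splice n w zeroWord = w := by
  funext k
  by_cases h : k < n
  · simp [splice, h]
  · simp [splice, h, zeroWord, hw k (Nat.not_lt.1 h)]

lemma splice_of_le {n m : ℕ} (h : n ≤ m) (w u : ℕ → Bool) :
    splice n w (splice m w u) = splice m w u := by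
  funext k
  by_cases hk : k < n
  · simp [splice, hk, hk.trans_le h]
  · simp [splice, hk]

end Splice

section Level

/-- `U` is a union of cylinders on words of length `n`. -/
def SetLevel (n : ℕ) (U : Set (ℕ → Bool)) : Prop := ∀ w ∈ U, ∀ u, splice n w u ∈ U

/-- `f` replaces prefixes of length `n` by prefixes of length `n`. -/
def Level (n : ℕ) (f : PEquiv (ℕ → Bool) (ℕ → Bool)) : Prop :=
  ∀ w w', w' ∈ f w → ∀ u, splice n w' u ∈ f (splice n w u)

/-- The domain of definition of a partial bijection. -/
def pdom (f : PEquiv (ℕ → Bool) (ℕ → Bool)) : Set (ℕ → Bool) := {w | ∃ w', w' ∈ f w}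

lemma mem_unique {f : PEquiv (ℕ → Bool) (ℕ → Bool)} {w a b : ℕ → Bool} (ha : a ∈ f w)
    (hb : b ∈ f w) : a = b := Option.mem_unique ha hb

lemma pequiv_ext {f g : PEquiv (ℕ → Bool) (ℕ → Bool)} (h : ∀ w w', w' ∈ f w ↔ w' ∈ g w) :
    f = g := PEquiv.ext fun w => Option.ext fun w' => h w w'

lemma SetLevel.mono {n m : ℕ} (h : n ≤ m) {U : Set (ℕ → Bool)} (hU : SetLevel n U) :
    SetLevel m U := fun w hw u => by
  rw [← splice_of_le h w u]; exact hU w hw _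

lemma SetLevel.compl {n : ℕ} {U : Set (ℕ → Bool)} (hU : SetLevel n U) : SetLevel n Uᶜ := by
  intro w hw u hmem
  have := hU _ hmem w
  rw [splice_splice_left, splice_self] at this
  exact hw this

lemma SetLevel.union {n : ℕ} {U V : Set (ℕ → Bool)} (hU : SetLevel n U) (hV : SetLevel n V) :
    SetLevel n (U ∪ V) := by
  rintro w (hw | hw) u
  · exact Or.inl (hU w hw u)
  · exact Or.inr (hV w hw u)

lemma SetLevel.mem_iff {n : ℕ} {U : Set (ℕ → Bool)} (hU : SetLevel n U) (w u : ℕ → Bool) :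
    splice n w u ∈ U ↔ w ∈ U := by
  refine ⟨fun h => ?_, fun h => hU w h u⟩
  have := hU _ h w
  rwa [splice_splice_left, splice_self] at this

lemma setLevel_preimage (n : ℕ) (A : Set (ℕ → Bool)) :
    SetLevel n {w | splice n w zeroWord ∈ A} := by
  intro w hw u
  simpa [splice_splice_left] using hw

lemma Level.eq_splice {n : ℕ} {f : PEquiv (ℕ → Bool) (ℕ → Bool)} (hf : Level n f)
    {w w' : ℕ → Bool} (h : w' ∈ f w) : w' = splice n w' w := by
  have := hf w w' h w
  rw [splice_self] at this
  exact mem_unique h this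

lemma Level.tail_eq {n : ℕ} {f : PEquiv (ℕ → Bool) (ℕ → Bool)} (hf : Level n f)
    {w w' : ℕ → Bool} (h : w' ∈ f w) {k : ℕ} (hk : n ≤ k) : w' k = w k := by
  rw [hf.eq_splice h]; simp [splice, Nat.not_lt.2 hk]

lemma Level.mono {n m : ℕ} (h : n ≤ m) {f : PEquiv (ℕ → Bool) (ℕ → Bool)} (hf : Level n f) :
    Level m f := by
  intro w w' hw u
  have h1 := hf w w' hw (splice m w u)
  rw [splice_of_le h] at h1
  convert h1 using 1
  funext k
  by_cases hk : k < n
  · simp [splice, hk, hk.trans_le h]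
  · simp [splice, hk, hf.tail_eq hw (Nat.not_lt.1 hk)]

lemma Level.symm {n : ℕ} {f : PEquiv (ℕ → Bool) (ℕ → Bool)} (hf : Level n f) :
    Level n f.symm := by
  intro w w' hw u
  rw [PEquiv.mem_iff_mem] at hw ⊢
  exact hf _ _ hw u

lemma Level.trans {n : ℕ} {f g : PEquiv (ℕ → Bool) (ℕ → Bool)} (hf : Level n f)
    (hg : Level n g) : Level n (f.trans g) := by
  intro w w' hw u
  rw [PEquiv.mem_trans] at hw ⊢
  obtain ⟨v, h1, h2⟩ := hw
  exact ⟨_, hf _ _ h1 u, hg _ _ h2 u⟩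

lemma Level.setLevel_pdom {n : ℕ} {f : PEquiv (ℕ → Bool) (ℕ → Bool)} (hf : Level n f) :
    SetLevel n (pdom f) := by
  rintro w ⟨w', hw⟩ u
  exact ⟨_, hf _ _ hw u⟩

lemma Level.mem_words {n : ℕ} {f : PEquiv (ℕ → Bool) (ℕ → Bool)} (hf : Level n f)
    {w w' : ℕ → Bool} (h : w' ∈ f w) (hw : w ∈ words n) : w' ∈ words n := fun k hk => by
  rw [hf.tail_eq h hk, hw k hk]

lemma level_of_le_refl {n : ℕ} {f : PEquiv (ℕ → Bool) (ℕ → Bool)}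
    (hf : ∀ w w', w' ∈ f w → w' = w) (h : SetLevel n (pdom f)) : Level n f := by
  intro w w' hw u
  obtain rfl := hf _ _ hw
  obtain ⟨v, hv⟩ := h w' ⟨w', hw⟩ u
  have := hf _ _ hv
  rwa [this] at hv

end Level

section Graph

lemma exists_pequiv_of_graph {R : (ℕ → Bool) → (ℕ → Bool) → Prop}
    (h1 : ∀ a b b', R a b → R a b' → b = b') (h2 : ∀ a a' b, R a b → R a' b → a = a') :
    ∃ f : PEquiv (ℕ → Bool) (ℕ → Bool), ∀ a b, b ∈ f a ↔ R a b := by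
  classical
  have key : ∀ (Q : (ℕ → Bool) → (ℕ → Bool) → Prop), (∀ a b b', Q a b → Q a b' → b = b') →
      ∀ a b, b ∈ (if h : ∃ b, Q a b then some h.choose else none) ↔ Q a b := by
    intro Q hQ a b
    by_cases h : ∃ b, Q a b
    · rw [dif_pos h, Option.mem_some_iff]
      exact ⟨fun e => e ▸ h.choose_spec, fun e => hQ _ _ _ h.choose_spec e⟩
    · rw [dif_neg h]
      simp only [Option.not_mem_none, false_iff]
      exact fun e => h ⟨b, e⟩
  refine ⟨⟨fun a => if h : ∃ b, R a b then some h.choose else none,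
    fun b => if h : ∃ a, R a b then some h.choose else none, fun a b => ?_⟩, fun a b => ?_⟩
  · exact (key (fun b a => R a b) (fun b a a' => h2 a a' b) b a).trans (key R h1 a b).symm
  · exact key R h1 a b

lemma exists_partial_identity (U : Set (ℕ → Bool)) :
    ∃ f : PEquiv (ℕ → Bool) (ℕ → Bool), ∀ a b, b ∈ f a ↔ b = a ∧ a ∈ U :=
  exists_pequiv_of_graph (by rintro a b b' ⟨rfl, -⟩ ⟨rfl, -⟩; rfl)
    (by rintro a b b' ⟨rfl, -⟩ ⟨rfl, -⟩; rfl)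

end Graph

section Words

lemma app_of_lt (x : List Bool) (u : ℕ → Bool) {k : ℕ} (h : k < x.length) :
    app x u k = x[k] := by simp [app, h]

lemma app_of_le (x : List Bool) (u : ℕ → Bool) {k : ℕ} (h : x.length ≤ k) :
    app x u k = u (k - x.length) := by simp [app, Nat.not_lt.2 h]

lemma splice_app {n : ℕ} (x : List Bool) (hx : x.length ≤ n) (u v : ℕ → Bool) :
    splice n (app x u) v =
      app x (fun k => if k + x.length < n then u k else v (k + x.length)) := by
  funext k
  by_cases h : k < x.length
  · simp [splice, h.trans_le hx, app_of_lt _ _ h]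
  · have h' := Nat.not_lt.1 h
    simp only [splice, app_of_le _ _ h', Nat.sub_add_cancel h']

/-- The prefix of length `n` of an infinite word. -/
def pre (n : ℕ) (w : ℕ → Bool) : List Bool := List.ofFn fun k : Fin n => w k

lemma length_pre (n : ℕ) (w : ℕ → Bool) : (pre n w).length = n := by simp [pre]

lemma app_pre (n : ℕ) (w v : ℕ → Bool) : app (pre n w) (fun k => v (k + n)) = splice n w v := by
  funext k
  by_cases h : k < n
  · rw [app_of_lt _ _ (by rwa [length_pre])]
    simp [pre, splice, h]
  · rw [app_of_le _ _ (by rw [length_pre]; omega)]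
    simp only [length_pre, splice, h, if_false]
    rw [Nat.sub_add_cancel (by omega)]

lemma eq_of_pre_isPrefix {n : ℕ} {w v : ℕ → Bool} (hw : w ∈ words n) (hv : v ∈ words n)
    (h : pre n w <+: pre n v) : w = v := by
  have h1 := h.eq_of_length (by simp [length_pre])
  rw [← splice_zeroWord_of_mem hw, ← splice_zeroWord_of_mem hv, ← app_pre, ← app_pre, h1]

lemma words_succ_split {n : ℕ} {U : Set (ℕ → Bool)} (hU : SetLevel n U) :
    U ∩ words (n + 1) =
      (U ∩ words n) ∪ (fun w => Function.update w n true) '' (U ∩ words n) := by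
  ext w
  have upd : ∀ v : ℕ → Bool, v ∈ U → ∀ b, Function.update v n b ∈ U := by
    intro v hv b
    have h : Function.update v n b = splice n v (Function.update v n b) := by
      funext k
      by_cases hk : k < n
      · simp [splice, hk, hk.ne]
      · simp [splice, hk]
    rw [h]; exact hU v hv _
  constructor
  · rintro ⟨h1, h2⟩
    by_cases hn : w n = true
    · refine Or.inr ⟨Function.update w n false, ⟨upd w h1 _, fun k hk => ?_⟩, ?_⟩
      · by_cases e : k = n
        · simp [e]
        · simp [e, h2 k (by omega)]
      · simp [← hn]
    · refine Or.inl ⟨h1, fun k hk => ?_⟩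
      by_cases e : k = n
      · simpa [e] using hn
      · exact h2 k (by omega)
  · rintro (⟨h1, h2⟩ | ⟨v, ⟨h1, h2⟩, rfl⟩)
    · exact ⟨h1, fun k hk => h2 k (by omega)⟩
    · refine ⟨upd v h1 _, fun k hk => ?_⟩
      have e : k ≠ n := by omega
      simp [e, h2 k (by omega)]

lemma finite_words (n : ℕ) : (words n).Finite := by
  induction n with
  | zero =>
    refine (Set.finite_singleton zeroWord).subset fun w hw => ?_
    funext k; exact hw k (Nat.zero_le k)
  | succ n ih =>
    have h := words_succ_split (n := n) (U := Set.univ) (fun _ _ _ => trivial)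
    rw [Set.univ_inter, Set.univ_inter] at h
    rw [h]
    exact ih.union (ih.image _)

lemma finite_inter_words (U : Set (ℕ → Bool)) (n : ℕ) : (U ∩ words n).Finite :=
  (finite_words n).subset Set.inter_subset_right

lemma ncard_succ {n : ℕ} {U : Set (ℕ → Bool)} (hU : SetLevel n U) :
    (U ∩ words (n + 1)).ncard = 2 * (U ∩ words n).ncard := by
  rw [words_succ_split hU, Set.ncard_union_eq ?_ (finite_inter_words U n)
    ((finite_inter_words U n).image _), Set.InjOn.ncard_image, two_mul]
  · intro v hv w hw h
    funext k
    by_cases e : k = n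
    · rw [e, hv.2 n le_rfl, hw.2 n le_rfl]
    · simpa [e] using congrFun h k
  · rw [Set.disjoint_left]
    rintro w hw ⟨v, -, rfl⟩
    simpa using hw.2 n le_rfl

lemma ncard_add {n : ℕ} {U : Set (ℕ → Bool)} (hU : SetLevel n U) (k : ℕ) :
    (U ∩ words (n + k)).ncard = 2 ^ k * (U ∩ words n).ncard := by
  induction k with
  | zero => simp
  | succ k ih =>
    rw [← Nat.add_assoc, ncard_succ (hU.mono (Nat.le_add_right n k)), ih, pow_succ]; ring

lemma ncard_words (n : ℕ) : (words n).ncard = 2 ^ n := by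
  have h := ncard_add (n := 0) (U := Set.univ) (fun _ _ _ => trivial) n
  have h0 : words 0 = {zeroWord} := by
    ext w
    exact ⟨fun hw => funext fun k => hw k (Nat.zero_le k), fun hw k _ => by rw [hw]; rfl⟩
  simpa [h0] using h

end Words

section Measure

/-- `U` is clopen: a union of cylinders on words of some fixed length. -/
def IsCylindrical (U : Set (ℕ → Bool)) : Prop := ∃ n, SetLevel n U

open Classical in
/-- The Bernoulli measure of a clopen set (and `0` for other sets). -/
noncomputable def mu (U : Set (ℕ → Bool)) : ℚ :=
  if h : IsCylindrical U then ((U ∩ words h.choose).ncard : ℚ) / 2 ^ h.choose else 0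

lemma mu_eq {n : ℕ} {U : Set (ℕ → Bool)} (hU : SetLevel n U) :
    mu U = ((U ∩ words n).ncard : ℚ) / 2 ^ n := by
  have h : IsCylindrical U := ⟨n, hU⟩
  have hc : ∀ m k : ℕ, SetLevel m U →
      ((U ∩ words (m + k)).ncard : ℚ) / 2 ^ (m + k) = ((U ∩ words m).ncard : ℚ) / 2 ^ m := by
    intro m k hm
    rw [ncard_add hm, pow_add]
    push_cast
    field_simp
  rw [mu, dif_pos h, ← hc _ n h.choose_spec, ← hc n h.choose hU, Nat.add_comm n]

lemma IsCylindrical.common {U V : Set (ℕ → Bool)} (hU : IsCylindrical U)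
    (hV : IsCylindrical V) : ∃ n, SetLevel n U ∧ SetLevel n V := by
  obtain ⟨n, hn⟩ := hU
  obtain ⟨m, hm⟩ := hV
  exact ⟨max n m, hn.mono (le_max_left _ _), hm.mono (le_max_right _ _)⟩

lemma IsCylindrical.compl {U : Set (ℕ → Bool)} (hU : IsCylindrical U) : IsCylindrical Uᶜ :=
  hU.imp fun _ h => h.compl

lemma IsCylindrical.union {U V : Set (ℕ → Bool)} (hU : IsCylindrical U)
    (hV : IsCylindrical V) : IsCylindrical (U ∪ V) :=
  (hU.common hV).imp fun _ h => h.1.union h.2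

lemma isCylindrical_empty : IsCylindrical ∅ := ⟨0, fun _ h => h.elim⟩

lemma mu_union {U V : Set (ℕ → Bool)} (hU : IsCylindrical U) (hV : IsCylindrical V)
    (h : Disjoint U V) : mu (U ∪ V) = mu U + mu V := by
  obtain ⟨n, h1, h2⟩ := hU.common hV
  rw [mu_eq (h1.union h2), mu_eq h1, mu_eq h2, Set.union_inter_distrib_right,
    Set.ncard_union_eq (h.mono Set.inter_subset_left Set.inter_subset_left)
      (finite_inter_words U n) (finite_inter_words V n)]
  push_cast
  ring

lemma mu_empty : mu ∅ = 0 := by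
  rw [mu_eq (n := 0) (fun _ h => h.elim)]; simp

lemma mu_univ : mu Set.univ = 1 := by
  rw [mu_eq (n := 0) (U := Set.univ) (fun _ _ _ => trivial), Set.univ_inter, ncard_words]; simp

lemma mu_nonneg (U : Set (ℕ → Bool)) : 0 ≤ mu U := by
  unfold mu; split_ifs <;> positivity

lemma mu_compl {U : Set (ℕ → Bool)} (hU : IsCylindrical U) : mu Uᶜ = 1 - mu U := by
  have := mu_union hU hU.compl disjoint_compl_right
  rw [Set.union_compl_self, mu_univ] at this
  linarith

lemma mu_le_one {U : Set (ℕ → Bool)} (hU : IsCylindrical U) : mu U ≤ 1 := by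
  have := mu_nonneg Uᶜ
  rw [mu_compl hU] at this
  linarith

lemma mu_mono {U V : Set (ℕ → Bool)} (hU : IsCylindrical U) (hV : IsCylindrical V)
    (h : U ⊆ V) : mu U ≤ mu V := by
  obtain ⟨n, h1, h2⟩ := hU.common hV
  rw [mu_eq h1, mu_eq h2]
  have := Set.ncard_le_ncard (Set.inter_subset_inter_left (words n) h) (finite_inter_words V n)
  gcongr

lemma isDyadic_mu {U : Set (ℕ → Bool)} (hU : IsCylindrical U) : IsDyadic (mu U) := by
  obtain ⟨n, h⟩ := hU
  exact ⟨_, n, mu_eq h⟩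

lemma ncard_le_of_mu_le {n : ℕ} {U V : Set (ℕ → Bool)} (hU : SetLevel n U) (hV : SetLevel n V)
    (h : mu U ≤ mu V) : (U ∩ words n).ncard ≤ (V ∩ words n).ncard := by
  rw [mu_eq hU, mu_eq hV, div_le_div_iff_of_pos_right (by positivity)] at h
  exact_mod_cast h

lemma SetLevel.subset_of_inter {n : ℕ} {U V : Set (ℕ → Bool)} (hU : SetLevel n U)
    (hV : SetLevel n V) (h : U ∩ words n ⊆ V ∩ words n) : U ⊆ V := fun w hw =>
  (hV.mem_iff w zeroWord).1 (h ⟨hU w hw _, splice_zeroWord_mem n w⟩).1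

lemma eq_of_subset_of_mu_le {U V : Set (ℕ → Bool)} (hU : IsCylindrical U)
    (hV : IsCylindrical V) (h : U ⊆ V) (hm : mu V ≤ mu U) : U = V := by
  obtain ⟨n, h1, h2⟩ := hU.common hV
  refine h.antisymm (h2.subset_of_inter h1 ?_)
  exact (Set.eq_of_subset_of_ncard_le (Set.inter_subset_inter_left (words n) h)
    (ncard_le_of_mu_le h2 h1 hm) (finite_inter_words V n)).ge

lemma exists_setLevel_of_subset {n : ℕ} {A : Set (ℕ → Bool)} (hA : A ⊆ words n) :
    ∃ V, SetLevel n V ∧ V ∩ words n = A := by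
  refine ⟨{w | splice n w zeroWord ∈ A}, setLevel_preimage n A, ?_⟩
  ext w
  constructor
  · rintro ⟨h1, h2⟩
    rwa [Set.mem_ofPred_eq, splice_zeroWord_of_mem h2] at h1
  · intro h
    refine ⟨?_, hA h⟩
    rwa [Set.mem_ofPred_eq, splice_zeroWord_of_mem (hA h)]

lemma exists_subset_mu_eq {U V : Set (ℕ → Bool)} (hU : IsCylindrical U) (hV : IsCylindrical V)
    (h : mu U ≤ mu V) : ∃ V' ⊆ V, IsCylindrical V' ∧ mu V' = mu U := by
  obtain ⟨n, h1, h2⟩ := hU.common hV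
  obtain ⟨A, hA, hc⟩ := Set.exists_subset_card_eq (ncard_le_of_mu_le h1 h2 h)
  obtain ⟨V', hV', e⟩ := exists_setLevel_of_subset (hA.trans Set.inter_subset_right)
  refine ⟨V', hV'.subset_of_inter h2 (e.trans_subset hA), ⟨n, hV'⟩, ?_⟩
  rw [mu_eq hV', e, hc, mu_eq h1]

lemma exists_mu_eq {q : ℚ} (h1 : q ≤ 1) (hq : IsDyadic q) :
    ∃ U, IsCylindrical U ∧ mu U = q := by
  obtain ⟨a, b, rfl⟩ := hq
  have hle : a ≤ (words b).ncard := by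
    rw [ncard_words]
    rw [div_le_one (by positivity)] at h1
    exact_mod_cast h1
  obtain ⟨A, hA, hc⟩ := Set.exists_subset_card_eq hle
  obtain ⟨V, hV, e⟩ := exists_setLevel_of_subset hA
  exact ⟨V, ⟨b, hV⟩, by rw [mu_eq hV, e, hc]⟩

lemma setLevel_cyl (x : List Bool) : SetLevel x.length (cyl x) := by
  rintro _ ⟨u, rfl⟩ v
  exact ⟨_, splice_app x le_rfl u v⟩

lemma mu_cyl (x : List Bool) : mu (cyl x) = ((1 : ℚ) / 2) ^ x.length := by
  have h : cyl x ∩ words x.length = {app x zeroWord} := by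
    ext w
    constructor
    · rintro ⟨⟨u, rfl⟩, hw⟩
      have : u = zeroWord := by
        funext k
        have := hw (k + x.length) (by omega)
        rw [app_of_le _ _ (by omega)] at this
        simpa [zeroWord] using this
      rw [this]; rfl
    · rintro rfl
      refine ⟨⟨_, rfl⟩, fun k hk => ?_⟩
      rw [app_of_le _ _ hk]; rfl
  rw [mu_eq (setLevel_cyl x), h]
  simp

lemma isPrefix_of_app_eq {x y : List Bool} {u v : ℕ → Bool} (h : app x u = app y v)
    (hl : x.length ≤ y.length) : x <+: y := by
  rw [List.prefix_iff_eq_take]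
  refine List.ext_getElem (by simp [hl]) fun k h1 h2 => ?_
  have := congrFun h k
  rw [app_of_lt _ _ h1, app_of_lt _ _ (h1.trans_le hl)] at this
  simpa using this

lemma disjoint_cyl {x y : List Bool} (h1 : ¬ x <+: y) (h2 : ¬ y <+: x) :
    Disjoint (cyl x) (cyl y) := by
  rw [Set.disjoint_left]
  rintro w ⟨u, rfl⟩ ⟨v, hv⟩
  rcases le_total x.length y.length with h | h
  · exact h1 (isPrefix_of_app_eq hv h)
  · exact h2 (isPrefix_of_app_eq hv.symm h)

lemma mu_cylU {X : Finset (List Bool)} (hX : IsPrefixCode X) :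
    IsCylindrical (cylU X) ∧ mu (cylU X) = ∑ x ∈ X, ((1 : ℚ) / 2) ^ x.length := by
  classical
  induction X using Finset.induction_on with
  | empty => simpa [cylU, mu_empty] using isCylindrical_empty
  | insert a X ha ih =>
    obtain ⟨h1, h2⟩ := ih fun x hx y hy =>
      hX x (Finset.mem_insert_of_mem hx) y (Finset.mem_insert_of_mem hy)
    have e : cylU (insert a X) = cyl a ∪ cylU X := by simp [cylU]
    have hca : IsCylindrical (cyl a) := ⟨_, setLevel_cyl a⟩
    refine ⟨e ▸ hca.union h1, ?_⟩
    rw [e, mu_union hca h1, mu_cyl, h2, Finset.sum_insert ha]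
    simp only [cylU, Set.disjoint_iUnion_right]
    intro x hx
    refine disjoint_cyl (fun h => ha ?_) (fun h => ha ?_)
    · rwa [hX a (Finset.mem_insert_self _ _) x (Finset.mem_insert_of_mem hx) h]
    · rwa [← hX x (Finset.mem_insert_of_mem hx) a (Finset.mem_insert_self _ _) h]

lemma mu_pdom_trans_le {f g : PEquiv (ℕ → Bool) (ℕ → Bool)} (hf : ∃ n, Level n f)
    (hg : ∃ n, Level n g) : mu (pdom (f.trans g)) ≤ mu (pdom g) := by
  obtain ⟨n, hn⟩ := hf
  obtain ⟨m, hm⟩ := hg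
  replace hn := hn.mono (le_max_left n m)
  replace hm := hm.mono (le_max_right n m)
  rw [mu_eq (hn.trans hm).setLevel_pdom, mu_eq hm.setLevel_pdom]
  have key : ∀ w ∈ pdom (f.trans g), ∃ v, v ∈ f w ∧ v ∈ pdom g := by
    rintro w ⟨w', h⟩
    obtain ⟨v, h1, h2⟩ := (PEquiv.mem_trans f g _ _).1 h
    exact ⟨v, h1, _, h2⟩
  choose! F hF using key
  have := Set.ncard_le_ncard_of_injOn (s := pdom (f.trans g) ∩ words (max n m))
    (t := pdom g ∩ words (max n m)) F
    (fun w hw => ⟨(hF w hw.1).2, hn.mem_words (hF w hw.1).1 hw.2⟩)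
    (fun w hw v hv h => f.inj (hF w hw.1).1 (h ▸ (hF v hv.1).1)) (finite_inter_words _ _)
  gcongr

lemma Level.isCylindrical_pdom {f : PEquiv (ℕ → Bool) (ℕ → Bool)} (hf : ∃ n, Level n f) :
    IsCylindrical (pdom f) := hf.imp fun _ h => h.setLevel_pdom

lemma pdom_trans_subset (f g : PEquiv (ℕ → Bool) (ℕ → Bool)) : pdom (f.trans g) ⊆ pdom f := by
  rintro w ⟨w', h⟩
  obtain ⟨v, h1, -⟩ := (PEquiv.mem_trans f g _ _).1 h
  exact ⟨v, h1⟩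

lemma pdom_trans_symm (f : PEquiv (ℕ → Bool) (ℕ → Bool)) : pdom (f.trans f.symm) = pdom f := by
  refine (pdom_trans_subset _ _).antisymm ?_
  rintro w ⟨w', h⟩
  exact ⟨w, (PEquiv.mem_trans _ _ _ _).2 ⟨w', h, (PEquiv.mem_iff_mem f).2 h⟩⟩

lemma mu_pdom_le_symm {f : PEquiv (ℕ → Bool) (ℕ → Bool)} (hf : ∃ n, Level n f) :
    mu (pdom f) ≤ mu (pdom f.symm) := by
  have := mu_pdom_trans_le hf (hf.imp fun _ h => h.symm)
  rwa [pdom_trans_symm] at this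

lemma mu_pdom_symm {f : PEquiv (ℕ → Bool) (ℕ → Bool)} (hf : ∃ n, Level n f) :
    mu (pdom f.symm) = mu (pdom f) :=
  le_antisymm (mu_pdom_le_symm (hf.imp fun _ h => h.symm)) (mu_pdom_le_symm hf)

lemma exists_level_of_mu_eq {U V : Set (ℕ → Bool)} (hU : IsCylindrical U)
    (hV : IsCylindrical V) (h : mu U = mu V) :
    ∃ f, (∃ n, Level n f) ∧ pdom f = U ∧ pdom f.symm = V := by
  obtain ⟨n, h1, h2⟩ := hU.common hV
  have hc := le_antisymm (ncard_le_of_mu_le h1 h2 h.le) (ncard_le_of_mu_le h2 h1 h.ge)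
  have hfU := (finite_inter_words U n).to_subtype
  have hfV := (finite_inter_words V n).to_subtype
  obtain ⟨σ⟩ : Nonempty (↥(U ∩ words n) ≃ ↥(V ∩ words n)) :=
    Finite.card_eq.1 hc
  have hs : ∀ {w}, w ∈ U → splice n w zeroWord ∈ U ∩ words n :=
    fun {w} hw => ⟨h1 w hw _, splice_zeroWord_mem n w⟩
  have ht : ∀ {w}, w ∈ V → splice n w zeroWord ∈ V ∩ words n :=
    fun {w} hw => ⟨h2 w hw _, splice_zeroWord_mem n w⟩
  have split : ∀ {a b : ℕ → Bool}, splice n a zeroWord = splice n b zeroWord →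
      (∀ k, n ≤ k → a k = b k) → a = b := by
    intro a b e et
    funext k
    by_cases hk : k < n
    · simpa [splice, hk] using congrFun e k
    · exact et k (Nat.not_lt.1 hk)
  obtain ⟨f, hf⟩ := exists_pequiv_of_graph
    (R := fun a b => ∃ (ha : a ∈ U) (hb : b ∈ V),
      σ ⟨_, hs ha⟩ = ⟨_, ht hb⟩ ∧ ∀ k, n ≤ k → a k = b k)
    (by
      rintro a b b' ⟨ha, hb, e, et⟩ ⟨ha', hb', e', et'⟩
      refine split (congrArg Subtype.val (e.symm.trans e')) fun k hk => ?_
      rw [← et k hk, et' k hk])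
    (by
      rintro a a' b ⟨ha, hb, e, et⟩ ⟨ha', hb', e', et'⟩
      refine split (congrArg Subtype.val (σ.injective (e.trans e'.symm))) fun k hk => ?_
      rw [et k hk, et' k hk])
  refine ⟨f, ⟨n, ?_⟩, ?_, ?_⟩
  · intro w w' hw u
    rw [hf] at hw ⊢
    obtain ⟨ha, hb, e, et⟩ := hw
    refine ⟨h1 _ ha _, h2 _ hb _, ?_, fun k hk => ?_⟩
    · simpa only [splice_splice_left] using e
    · simp [splice, Nat.not_lt.2 hk]
  · ext w
    constructor
    · rintro ⟨w', hw⟩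
      exact ((hf _ _).1 hw).1
    · intro hw
      obtain ⟨⟨v, hv⟩, e⟩ : ∃ v, σ ⟨_, hs hw⟩ = v := ⟨_, rfl⟩
      refine ⟨splice n v w, (hf _ _).2 ⟨hw, h2 _ hv.1 _, ?_, fun k hk => ?_⟩⟩
      · simp only [e, splice_splice_left, splice_zeroWord_of_mem hv.2]
      · simp [splice, Nat.not_lt.2 hk]
  · ext w
    constructor
    · rintro ⟨w', hw⟩
      rw [PEquiv.mem_iff_mem] at hw
      exact ((hf _ _).1 hw).2.1
    · intro hw
      obtain ⟨⟨v, hv⟩, e⟩ := σ.surjective ⟨_, ht hw⟩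
      refine ⟨splice n v w, (PEquiv.mem_iff_mem f).2
        ((hf _ _).2 ⟨h1 _ hv.1 _, hw, ?_, fun k hk => ?_⟩)⟩
      · rw [← e]; simp only [splice_splice_left, splice_zeroWord_of_mem hv.2]
      · simp [splice, Nat.not_lt.2 hk]

end Measure

section DyadicMonoid

lemma exists_level_of_mem_Ad2Set {f : PEquiv (ℕ → Bool) (ℕ → Bool)} (hf : f ∈ Ad2Set) :
    ∃ n, Level n f := by
  obtain ⟨r, x, y, -, -, hl, hf⟩ := hf
  refine ⟨Finset.univ.sup fun i => (x i).length, fun w w' hw v => ?_⟩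
  obtain ⟨i, u, rfl, rfl⟩ := (hf _ _).1 hw
  have hi : (x i).length ≤ Finset.univ.sup fun i => (x i).length :=
    Finset.le_sup (f := fun i => (x i).length) (Finset.mem_univ i)
  exact (hf _ _).2 ⟨i, _, splice_app _ hi u v, by rw [splice_app _ (hl i ▸ hi), hl i]⟩

lemma mem_Ad2Set_of_level {n : ℕ} {f : PEquiv (ℕ → Bool) (ℕ → Bool)} (hf : Level n f) :
    f ∈ Ad2Set := by
  have hfin := (finite_inter_words (pdom f) n).to_subtype
  obtain ⟨r, ⟨ε⟩⟩ := Finite.exists_equiv_fin ↥(pdom f ∩ words n)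
  have hex : ∀ i : Fin r, ∃ v, v ∈ f (ε.symm i).1 := fun i => (ε.symm i).2.1
  choose F hF using hex
  refine ⟨r, fun i => pre n (ε.symm i).1, fun i => pre n (F i), ?_, ?_, ?_, ?_⟩
  · intro i j h
    exact ε.symm.injective (Subtype.ext (eq_of_pre_isPrefix (ε.symm i).2.2 (ε.symm j).2.2 h))
  · intro i j h
    have e := eq_of_pre_isPrefix (hf.mem_words (hF i) (ε.symm i).2.2)
      (hf.mem_words (hF j) (ε.symm j).2.2) h
    exact ε.symm.injective (Subtype.ext (f.inj (hF i) (e ▸ hF j)))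
  · intro i
    simp [length_pre]
  · intro w w'
    constructor
    · intro hw
      have h0 := hf w w' hw zeroWord
      obtain ⟨i, hi⟩ := ε.symm.surjective
        ⟨splice n w zeroWord, ⟨_, h0⟩, splice_zeroWord_mem n w⟩
      have hi' : (ε.symm i).1 = splice n w zeroWord := congrArg Subtype.val hi
      have hFi : F i = splice n w' zeroWord := by
        have := hF i
        rw [hi'] at this
        exact mem_unique this h0
      refine ⟨i, fun k => w (k + n), ?_, ?_⟩
      · rw [app_pre, hi', splice_splice_left, splice_self]
      · rw [app_pre, hFi, splice_splice_left]
        exact hf.eq_splice hw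
    · rintro ⟨i, u, rfl, rfl⟩
      have hu : u = fun k => (fun m => u (m - n)) (k + n) := by funext k; simp
      have h := hf _ _ (hF i) fun m => u (m - n)
      rwa [← app_pre, ← app_pre, ← hu] at h

lemma mem_Ad2Set_iff {f : PEquiv (ℕ → Bool) (ℕ → Bool)} : f ∈ Ad2Set ↔ ∃ n, Level n f :=
  ⟨exists_level_of_mem_Ad2Set, fun ⟨_, h⟩ => mem_Ad2Set_of_level h⟩

/-- The underlying type of the dyadic inverse monoid. -/
abbrev Ad2 : Type := ↥Ad2Set

lemma Ad2.exists_level (a : Ad2) : ∃ n, Level n a.1 := mem_Ad2Set_iff.1 a.2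

lemma Ad2.common_level (a b : Ad2) : ∃ n, Level n a.1 ∧ Level n b.1 := by
  obtain ⟨n, hn⟩ := a.exists_level
  obtain ⟨m, hm⟩ := b.exists_level
  exact ⟨max n m, hn.mono (le_max_left _ _), hm.mono (le_max_right _ _)⟩

/-- The dyadic inverse monoid `Ad₂`. -/
def ad2Mon : InvMonData Ad2 where
  mul a b := ⟨b.1.trans a.1, mem_Ad2Set_iff.2 <|
    (Ad2.common_level b a).imp fun _ h => h.1.trans h.2⟩
  one := ⟨PEquiv.refl _, mem_Ad2Set_iff.2 ⟨0, level_of_le_refl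
    (fun _ _ h => (Option.mem_some_iff.1 h).symm) (fun _ _ u => ⟨_, rfl⟩)⟩⟩
  zero := ⟨⊥, mem_Ad2Set_iff.2 ⟨0, fun _ _ h => by simp at h⟩⟩
  inv a := ⟨a.1.symm, mem_Ad2Set_iff.2 <| a.exists_level.imp fun _ h => h.symm⟩

lemma Ad2.ext_mem {a b : Ad2} (h : ∀ w w', w' ∈ a.1 w ↔ w' ∈ b.1 w) : a = b :=
  Subtype.ext (pequiv_ext h)

lemma mem_mul {a b : Ad2} {w w' : ℕ → Bool} :
    w' ∈ (ad2Mon.mul a b).1 w ↔ ∃ v, v ∈ b.1 w ∧ w' ∈ a.1 v := PEquiv.mem_trans _ _ _ _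

lemma mem_inv {a : Ad2} {w w' : ℕ → Bool} : w' ∈ (ad2Mon.inv a).1 w ↔ w ∈ a.1 w' :=
  PEquiv.mem_iff_mem a.1

lemma mem_one {w w' : ℕ → Bool} : w' ∈ ad2Mon.one.1 w ↔ w' = w := by
  change w' ∈ some w ↔ _
  rw [Option.mem_some_iff, eq_comm]

lemma not_mem_zero {w w' : ℕ → Bool} : ¬ w' ∈ ad2Mon.zero.1 w := by
  change ¬ w' ∈ none
  simp

lemma isIdem_iff {e : Ad2} : IsIdem ad2Mon e ↔ ∀ w w', w' ∈ e.1 w → w' = w := by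
  constructor
  · intro h w w' hw
    have h1 := hw
    rw [← (h : ad2Mon.mul e e = e), mem_mul] at h1
    obtain ⟨v, hv, hv'⟩ := h1
    rw [← mem_unique hw hv] at hv'
    exact e.1.inj hv' hw
  · intro h
    refine Ad2.ext_mem fun w w' => ?_
    rw [mem_mul]
    constructor
    · rintro ⟨v, hv, hv'⟩
      rwa [← h _ _ hv]
    · intro hw
      obtain rfl := h _ _ hw
      exact ⟨w', hw, hw⟩

lemma IsIdem.mem_iff {e : Ad2} (he : IsIdem ad2Mon e) {w w' : ℕ → Bool} :
    w' ∈ e.1 w ↔ w' = w ∧ w ∈ pdom e.1 := by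
  constructor
  · intro h
    exact ⟨isIdem_iff.1 he _ _ h, _, h⟩
  · rintro ⟨rfl, v, hv⟩
    rwa [isIdem_iff.1 he _ _ hv] at hv

lemma IsIdem.ext {e f : Ad2} (he : IsIdem ad2Mon e) (hf : IsIdem ad2Mon f)
    (h : pdom e.1 = pdom f.1) : e = f :=
  Ad2.ext_mem fun w w' => by rw [he.mem_iff, hf.mem_iff, h]

lemma isCylindrical_pdom (a : Ad2) : IsCylindrical (pdom a.1) :=
  Level.isCylindrical_pdom a.exists_level

lemma exists_idem {U : Set (ℕ → Bool)} (hU : IsCylindrical U) :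
    ∃ e, IsIdem ad2Mon e ∧ pdom e.1 = U := by
  obtain ⟨f, hf⟩ := exists_partial_identity U
  have hd : pdom f = U := by
    ext w
    exact ⟨fun ⟨w', h⟩ => ((hf _ _).1 h).2, fun h => ⟨w, (hf _ _).2 ⟨rfl, h⟩⟩⟩
  have hr : ∀ w w', w' ∈ f w → w' = w := fun w w' h => ((hf _ _).1 h).1
  obtain ⟨n, hn⟩ := hU
  exact ⟨⟨f, mem_Ad2Set_iff.2 ⟨n, level_of_le_refl hr (hd ▸ hn)⟩⟩, isIdem_iff.2 hr, hd⟩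

lemma mem_inv_mul_self {a : Ad2} {w w' : ℕ → Bool} :
    w' ∈ (ad2Mon.mul (ad2Mon.inv a) a).1 w ↔ w' = w ∧ w ∈ pdom a.1 := by
  simp only [mem_mul, mem_inv]
  constructor
  · rintro ⟨v, h1, h2⟩
    exact ⟨a.1.inj h2 h1, v, h1⟩
  · rintro ⟨rfl, v, h⟩
    exact ⟨v, h, h⟩

lemma isIdem_inv_mul_self (a : Ad2) : IsIdem ad2Mon (ad2Mon.mul (ad2Mon.inv a) a) :=
  isIdem_iff.2 fun _ _ h => (mem_inv_mul_self.1 h).1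

lemma inv_inv (a : Ad2) : ad2Mon.inv (ad2Mon.inv a) = a :=
  Ad2.ext_mem fun w w' => by rw [mem_inv, mem_inv]

lemma pdom_inv_mul_self (a : Ad2) : pdom (ad2Mon.mul (ad2Mon.inv a) a).1 = pdom a.1 :=
  pdom_trans_symm a.1

lemma pdom_mul_inv_self (a : Ad2) :
    pdom (ad2Mon.mul a (ad2Mon.inv a)).1 = pdom (ad2Mon.inv a).1 := by
  have := pdom_inv_mul_self (ad2Mon.inv a)
  rwa [inv_inv] at this

lemma isIdem_mul_inv_self (a : Ad2) : IsIdem ad2Mon (ad2Mon.mul a (ad2Mon.inv a)) := by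
  have := isIdem_inv_mul_self (ad2Mon.inv a)
  rwa [inv_inv] at this

lemma nle_iff {a b : Ad2} : nle ad2Mon a b ↔ ∀ w w', w' ∈ a.1 w → w' ∈ b.1 w := by
  constructor
  · rintro ⟨e, he, rfl⟩ w w' h
    obtain ⟨v, h1, h2⟩ := mem_mul.1 h
    rwa [isIdem_iff.1 he _ _ h1] at h2
  · intro h
    refine ⟨_, isIdem_inv_mul_self a, Ad2.ext_mem fun w w' => ?_⟩
    simp only [mem_mul (a := b), mem_inv_mul_self]
    constructor
    · intro hw
      exact ⟨w, ⟨rfl, w', hw⟩, h _ _ hw⟩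
    · rintro ⟨v, ⟨rfl, v', hv⟩, hw⟩
      rwa [mem_unique hw (h _ _ hv)]

lemma nle_antisymm {a b : Ad2} (h1 : nle ad2Mon a b) (h2 : nle ad2Mon b a) : a = b :=
  Ad2.ext_mem fun w w' => ⟨nle_iff.1 h1 w w', nle_iff.1 h2 w w'⟩

lemma isJoin_of_mem_iff {a b j : Ad2} (h : ∀ w w', w' ∈ j.1 w ↔ w' ∈ a.1 w ∨ w' ∈ b.1 w) :
    IsJoin ad2Mon a b j := by
  simp only [IsJoin, nle_iff, h]
  exact ⟨fun _ _ => Or.inl, fun _ _ => Or.inr,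
    fun c h1 h2 w w' hw => hw.elim (h1 w w') (h2 w w')⟩

lemma exists_union {a b : Ad2} (h1 : ∀ w u v, u ∈ a.1 w → v ∈ b.1 w → u = v)
    (h2 : ∀ w u v, w ∈ a.1 u → w ∈ b.1 v → u = v) :
    ∃ j : Ad2, ∀ w w', w' ∈ j.1 w ↔ w' ∈ a.1 w ∨ w' ∈ b.1 w := by
  obtain ⟨f, hf⟩ := exists_pequiv_of_graph (R := fun w w' => w' ∈ a.1 w ∨ w' ∈ b.1 w)
    (by
      rintro w u v (hu | hu) (hv | hv)
      · exact mem_unique hu hv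
      · exact h1 _ _ _ hu hv
      · exact (h1 _ _ _ hv hu).symm
      · exact mem_unique hu hv)
    (by
      rintro u v w (hu | hu) (hv | hv)
      · exact a.1.inj hu hv
      · exact h2 _ _ _ hu hv
      · exact (h2 _ _ _ hv hu).symm
      · exact b.1.inj hu hv)
  obtain ⟨n, ha, hb⟩ := a.common_level b
  refine ⟨⟨f, mem_Ad2Set_iff.2 ⟨n, fun w w' hw u => ?_⟩⟩, hf⟩
  rw [hf] at hw ⊢
  exact hw.imp (fun h => ha _ _ h u) (fun h => hb _ _ h u)

lemma isJoin_iff {a b j : Ad2} :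
    IsJoin ad2Mon a b j ↔ ∀ w w', w' ∈ j.1 w ↔ w' ∈ a.1 w ∨ w' ∈ b.1 w := by
  refine ⟨fun h => ?_, isJoin_of_mem_iff⟩
  have ha := nle_iff.1 h.1
  have hb := nle_iff.1 h.2.1
  obtain ⟨i, hi⟩ := exists_union (a := a) (b := b)
    (fun w u v hu hv => mem_unique (ha _ _ hu) (hb _ _ hv))
    (fun w u v hu hv => j.1.inj (ha _ _ hu) (hb _ _ hv))
  have hj := isJoin_of_mem_iff hi
  have e : j = i := nle_antisymm (h.2.2 i hj.1 hj.2.1) (hj.2.2 j h.1 h.2.1)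
  rwa [e]

lemma isInverseMonoid_ad2 : IsInverseMonoid ad2Mon where
  mul_assoc a b c := Subtype.ext (PEquiv.trans_assoc c.1 b.1 a.1).symm
  one_mul a := Subtype.ext (PEquiv.trans_refl a.1)
  mul_one a := Subtype.ext (PEquiv.refl_trans a.1)
  zero_mul a := Ad2.ext_mem fun w w' => by
    simp only [mem_mul, not_mem_zero, and_false, exists_false]
  mul_zero a := Ad2.ext_mem fun w w' => by
    simp only [mem_mul, not_mem_zero, false_and, exists_false]
  inv_law₁ a := by
    refine Ad2.ext_mem fun w w' => ?_
    simp only [mem_mul, mem_inv]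
    constructor
    · rintro ⟨v, hv, u, hu, hw⟩
      rwa [a.1.inj hv hu]
    · intro h
      exact ⟨w', h, w, h, h⟩
  inv_law₂ a := by
    refine Ad2.ext_mem fun w w' => ?_
    simp only [mem_mul, mem_inv]
    constructor
    · rintro ⟨v, hv, u, hu, hw⟩
      rwa [mem_unique hv hu]
    · intro h
      exact ⟨w', h, w, h, h⟩
  inv_unique a b h1 h2 := by
    refine Ad2.ext_mem fun w w' => ?_
    rw [mem_inv]
    constructor
    · intro h
      have h3 := h
      rw [← h2] at h3
      simp only [mem_mul] at h3
      obtain ⟨v, hv, u, hu, hw⟩ := h3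
      have := mem_unique h hv
      subst this
      rwa [b.1.inj h hw]
    · intro h
      have h3 := h
      rw [← h1] at h3
      simp only [mem_mul] at h3
      obtain ⟨v, hv, u, hu, hw⟩ := h3
      have := mem_unique h hv
      subst this
      rwa [a.1.inj h hw]

lemma pdom_zero : pdom ad2Mon.zero.1 = ∅ := by
  ext w
  simp only [pdom, Set.mem_ofPred_eq, not_mem_zero, exists_false, Set.mem_empty_iff_false]

lemma pdom_one : pdom ad2Mon.one.1 = Set.univ := by
  ext w
  simp only [pdom, Set.mem_ofPred_eq, mem_one, exists_eq, Set.mem_univ]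

lemma mul_eq_zero_iff {e f : Ad2} (he : IsIdem ad2Mon e) (hf : IsIdem ad2Mon f) :
    ad2Mon.mul e f = ad2Mon.zero ↔ Disjoint (pdom e.1) (pdom f.1) := by
  rw [Set.disjoint_left]
  constructor
  · intro h w h1 h2
    have : w ∈ (ad2Mon.mul e f).1 w :=
      mem_mul.2 ⟨w, hf.mem_iff.2 ⟨rfl, h2⟩, he.mem_iff.2 ⟨rfl, h1⟩⟩
    rw [h] at this
    exact not_mem_zero this
  · intro h
    refine Ad2.ext_mem fun w w' => ?_
    simp only [mem_mul, not_mem_zero, iff_false]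
    rintro ⟨v, h1, h2⟩
    obtain ⟨rfl, h3⟩ := hf.mem_iff.1 h1
    exact h (he.mem_iff.1 h2).2 h3

lemma IsJoin.pdom_eq {a b j : Ad2} (h : IsJoin ad2Mon a b j) :
    pdom j.1 = pdom a.1 ∪ pdom b.1 := by
  ext w
  simp only [pdom, Set.mem_ofPred_eq, isJoin_iff.1 h, Set.mem_union, exists_or]

lemma isJoin_of_pdom_eq {e f j : Ad2} (he : IsIdem ad2Mon e) (hf : IsIdem ad2Mon f)
    (hj : IsIdem ad2Mon j) (h : pdom j.1 = pdom e.1 ∪ pdom f.1) : IsJoin ad2Mon e f j := by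
  refine isJoin_iff.2 fun w w' => ?_
  rw [hj.mem_iff, he.mem_iff, hf.mem_iff, h, Set.mem_union]
  tauto

lemma isIdem_one : IsIdem ad2Mon ad2Mon.one := isIdem_iff.2 fun _ _ => mem_one.1

lemma isComplPair_iff {e f : Ad2} : IsComplPair ad2Mon e f ↔
    IsIdem ad2Mon e ∧ IsIdem ad2Mon f ∧ pdom f.1 = (pdom e.1)ᶜ := by
  constructor
  · rintro ⟨he, hf, h0, hj⟩
    have h := hj.pdom_eq
    rw [pdom_one] at h
    exact ⟨he, hf, (IsCompl.of_eq (Set.disjoint_iff_inter_eq_empty.1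
      ((mul_eq_zero_iff he hf).1 h0)) h.symm).compl_eq.symm⟩
  · rintro ⟨he, hf, h⟩
    refine ⟨he, hf, (mul_eq_zero_iff he hf).2 (h ▸ disjoint_compl_right),
      isJoin_of_pdom_eq he hf isIdem_one ?_⟩
    rw [pdom_one, h, Set.union_compl_self]

lemma isBooleanInverseMonoid_ad2 : IsBooleanInverseMonoid ad2Mon where
  invMon := isInverseMonoid_ad2
  joins_exist a b h := by
    obtain ⟨j, hj⟩ := exists_union (a := a) (b := b)
      (fun w u v hu hv =>
        (isIdem_iff.1 h.2 v u (mem_mul.2 ⟨w, mem_inv.2 hv, hu⟩)))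
      (fun w u v hu hv =>
        (isIdem_iff.1 h.1 v u (mem_mul.2 ⟨w, hv, mem_inv.2 hu⟩)))
    exact ⟨j, isJoin_of_mem_iff hj⟩
  mul_join_left c a b j h := by
    rw [isJoin_iff] at h ⊢
    intro w w'
    simp only [mem_mul, h, or_and_right, exists_or]
  mul_join_right c a b j h := by
    rw [isJoin_iff] at h ⊢
    intro w w'
    simp only [mem_mul, h, and_or_left, exists_or]
  compl_exists e he := by
    obtain ⟨f, hf, hd⟩ := exists_idem (isCylindrical_pdom e).compl
    exact ⟨f, isComplPair_iff.2 ⟨he, hf, hd⟩⟩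

lemma mu_pdom_eq_of_dRel {e f : Ad2} (h : DRel ad2Mon e f) : mu (pdom e.1) = mu (pdom f.1) := by
  obtain ⟨a, rfl, rfl⟩ := h
  rw [pdom_inv_mul_self, pdom_mul_inv_self]
  exact (mu_pdom_symm a.exists_level).symm

lemma dRel_iff {e f : Ad2} (he : IsIdem ad2Mon e) (hf : IsIdem ad2Mon f) :
    DRel ad2Mon e f ↔ mu (pdom e.1) = mu (pdom f.1) := by
  refine ⟨mu_pdom_eq_of_dRel, fun h => ?_⟩
  obtain ⟨a, ha, h1, h2⟩ :=
    exists_level_of_mu_eq (isCylindrical_pdom e) (isCylindrical_pdom f) h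
  refine ⟨⟨a, mem_Ad2Set_iff.2 ha⟩, (isIdem_inv_mul_self _).ext he ?_,
    (isIdem_mul_inv_self _).ext hf ?_⟩
  · rw [pdom_inv_mul_self]; exact h1
  · rw [pdom_mul_inv_self]; exact h2

lemma pdom_subset_of_nle {a b : Ad2} (h : nle ad2Mon a b) : pdom a.1 ⊆ pdom b.1 :=
  fun _ ⟨_, hw⟩ => ⟨_, nle_iff.1 h _ _ hw⟩

lemma isFoulis_ad2 : IsFoulis ad2Mon := by
  refine ⟨isBooleanInverseMonoid_ad2, ?_, ?_⟩
  · intro e f he hf hD hle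
    exact (hf.ext he (eq_of_subset_of_mu_le (isCylindrical_pdom f) (isCylindrical_pdom e)
      (pdom_subset_of_nle hle) (mu_pdom_eq_of_dRel hD).le)).symm
  · intro e f e' f' hD he hf
    obtain ⟨-, he', e1⟩ := isComplPair_iff.1 he
    obtain ⟨-, hf', e2⟩ := isComplPair_iff.1 hf
    rw [dRel_iff he' hf', e1, e2, mu_compl (isCylindrical_pdom e),
      mu_compl (isCylindrical_pdom f), mu_pdom_eq_of_dRel hD]

lemma jle_iff {s t : Ad2} : Jle ad2Mon s t ↔ mu (pdom s.1) ≤ mu (pdom t.1) := by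
  constructor
  · rintro ⟨a, b, rfl⟩
    refine (mu_pdom_trans_le b.exists_level (ad2Mon.mul a t).exists_level).trans ?_
    exact mu_mono (isCylindrical_pdom _) (isCylindrical_pdom _) (pdom_trans_subset _ _)
  · intro h
    obtain ⟨V, hVt, hV, hm⟩ :=
      exists_subset_mu_eq (isCylindrical_pdom s) (isCylindrical_pdom t) h
    obtain ⟨b, hb, h1, h2⟩ := exists_level_of_mu_eq (isCylindrical_pdom s) hV hm.symm
    obtain ⟨b, rfl⟩ : ∃ b' : Ad2, b'.1 = b := ⟨⟨b, mem_Ad2Set_iff.2 hb⟩, rfl⟩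
    have hd : pdom (ad2Mon.mul t b).1 = pdom s.1 := by
      rw [← h1]
      refine (pdom_trans_subset _ _).antisymm ?_
      rintro w ⟨v, hv⟩
      have hvV : v ∈ V := h2 ▸ ⟨w, (PEquiv.mem_iff_mem _).2 hv⟩
      obtain ⟨u, hu⟩ := hVt hvV
      exact ⟨u, mem_mul.2 ⟨v, hv, hu⟩⟩
    refine ⟨ad2Mon.mul s (ad2Mon.inv (ad2Mon.mul t b)), b, ?_⟩
    rw [isInverseMonoid_ad2.mul_assoc, isInverseMonoid_ad2.mul_assoc]
    refine Ad2.ext_mem fun w w' => ?_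
    rw [mem_mul (a := s)]
    simp only [mem_inv_mul_self, hd]
    constructor
    · intro hw
      exact ⟨w, ⟨rfl, w', hw⟩, hw⟩
    · rintro ⟨v, ⟨rfl, -⟩, hw⟩
      exact hw

lemma latticeCondition_ad2 : LatticeCondition ad2Mon := by
  intro s t
  simp only [jle_iff]
  rcases le_total (mu (pdom s.1)) (mu (pdom t.1)) with h | h
  · exact ⟨⟨s, le_rfl, h, fun _ h1 _ => h1⟩, ⟨t, h, le_rfl, fun _ _ h1 => h1⟩⟩
  · exact ⟨⟨t, h, le_rfl, fun _ _ h1 => h1⟩, ⟨s, le_rfl, h, fun _ h1 _ => h1⟩⟩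

/-- The Bernoulli measure of the domain of an element of `Ad₂`. -/
noncomputable def ad2Measure (a : Ad2) : DyadicUnit :=
  ⟨mu (pdom a.1), mu_nonneg _, mu_le_one (isCylindrical_pdom a),
    isDyadic_mu (isCylindrical_pdom a)⟩

lemma ad2Measure_eq_iff {a : Ad2} {q : DyadicUnit} :
    ad2Measure a = q ↔ mu (pdom a.1) = q.1 := Subtype.ext_iff

lemma dyadicAlg_add_eq_some {x y z : DyadicUnit} :
    dyadicAlg.add x y = some z ↔ x.1 + y.1 = z.1 := by
  simp only [dyadicAlg]
  split_ifs with h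
  · exact Option.some_inj.trans Subtype.ext_iff
  · exact ⟨fun e => e.elim, fun e => (h (e ▸ z.2.2.1)).elim⟩

lemma pdom_pidC (U : Set (ℕ → Bool)) : pdom (pidC U) = U := by
  classical
  ext w
  change (∃ w', w' ∈ if w ∈ U then some w else none) ↔ _
  by_cases h : w ∈ U <;> simp [h]

lemma oplusEq_iff {e f g : Ad2} (he : IsIdem ad2Mon e) (hf : IsIdem ad2Mon f)
    (hg : IsIdem ad2Mon g) :
    OplusEq ad2Mon e f g ↔ mu (pdom e.1) + mu (pdom f.1) = mu (pdom g.1) := by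
  constructor
  · rintro ⟨e', f', j, he', hf', h1, h2, h0, hj, h3⟩
    rw [mu_pdom_eq_of_dRel h1, mu_pdom_eq_of_dRel h2, ← mu_pdom_eq_of_dRel h3, hj.pdom_eq,
      mu_union (isCylindrical_pdom _) (isCylindrical_pdom _) ((mul_eq_zero_iff he' hf').1 h0)]
  · intro h
    have hle : mu (pdom f.1) ≤ mu (pdom e.1)ᶜ := by
      rw [mu_compl (isCylindrical_pdom e)]
      have := mu_le_one (isCylindrical_pdom g)
      linarith
    obtain ⟨V, hVe, hV, hm⟩ :=
      exists_subset_mu_eq (isCylindrical_pdom f) (isCylindrical_pdom e).compl hle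
    obtain ⟨f', hf', rfl⟩ := exists_idem hV
    obtain ⟨j, hj, hd⟩ := exists_idem ((isCylindrical_pdom e).union hV)
    have hdis : Disjoint (pdom e.1) (pdom f'.1) := disjoint_compl_right.mono_right hVe
    refine ⟨e, f', j, he, hf', (dRel_iff he he).2 rfl, (dRel_iff hf hf').2 hm.symm,
      (mul_eq_zero_iff he hf').2 hdis, isJoin_of_pdom_eq he hf' hj hd, (dRel_iff hj hg).2 ?_⟩
    rw [hd, mu_union (isCylindrical_pdom e) hV hdis, hm, h]

end DyadicMonoid

/-- The dyadic inverse monoid `Ad₂` is a Foulis monoid satisfying the lattice condition,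
and the map sending the `J`-class of an idempotent `1_U` (`U` clopen in `{a,b}^ω`) to the
Bernoulli measure `μ(U)` is an isomorphism of MV-algebras from `Ad₂/J` onto the MV-algebra
of dyadic rationals in `[0,1]`.  Hence the MV-algebra of dyadic rationals in `[0,1]` is
co-ordinatized by the dyadic inverse monoid. -/
theorem dyadic_coordinatization :
    ∃ (T : Type) (M : InvMonData T) (ι : T → PEquiv (ℕ → Bool) (ℕ → Bool)),
      -- ι identifies (T, M) with the dyadic inverse monoid Ad₂
      Function.Injective ι ∧
      ι M.one = PEquiv.refl (ℕ → Bool) ∧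
      ι M.zero = ⊥ ∧
      (∀ a b, ι (M.mul a b) = (ι b).trans (ι a)) ∧
      (∀ a, ι (M.inv a) = (ι a).symm) ∧
      Set.range ι = Ad2Set ∧
      -- Ad₂ is a Foulis monoid satisfying the lattice condition
      IsFoulis M ∧ LatticeCondition M ∧
      -- the measure map is an MV-algebra isomorphism from Ad₂/J onto the
      -- dyadic rationals in [0,1]
      (∃ φ : T → DyadicUnit,
        (∀ e (X : Finset (List Bool)), IsIdem M e → IsPrefixCode X →
          ι e = pidC (cylU X) →
          (φ e).1 = ∑ x ∈ X, ((1 : ℚ) / 2) ^ x.length) ∧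
        (∀ e f, IsIdem M e → IsIdem M f → (φ e = φ f ↔ DRel M e f)) ∧
        (∀ q : DyadicUnit, ∃ e, IsIdem M e ∧ φ e = q) ∧
        φ M.zero = dyadicAlg.zero ∧ φ M.one = dyadicAlg.one ∧
        (∀ e f z, IsIdem M e → IsIdem M f →
          (dyadicAlg.add (φ e) (φ f) = some z ↔
            ∃ g, IsIdem M g ∧ OplusEq M e f g ∧ φ g = z)) ∧
        (∀ e e', IsComplPair M e e' →
          dyadicAlg.add (φ e) (φ e') = some dyadicAlg.one)) := by
  refine ⟨Ad2, ad2Mon, Subtype.val, Subtype.val_injective, rfl, rfl, fun _ _ => rfl,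
    fun _ => rfl, Subtype.range_val, isFoulis_ad2, latticeCondition_ad2, ad2Measure,
    ?_, ?_, ?_, ?_, ?_, ?_, ?_⟩
  · intro e X _ hX h
    change mu (pdom e.1) = _
    rw [h, pdom_pidC, (mu_cylU hX).2]
  · intro e f he hf
    rw [dRel_iff he hf]
    exact ad2Measure_eq_iff
  · intro q
    obtain ⟨U, hU, hq⟩ := exists_mu_eq q.2.2.1 q.2.2.2
    obtain ⟨e, he, rfl⟩ := exists_idem hU
    exact ⟨e, he, ad2Measure_eq_iff.2 hq⟩
  · rw [ad2Measure_eq_iff, pdom_zero, mu_empty]; rfl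
  · rw [ad2Measure_eq_iff, pdom_one, mu_univ]; rfl
  · intro e f z he hf
    rw [dyadicAlg_add_eq_some]
    constructor
    · intro h
      obtain ⟨U, hU, hq⟩ := exists_mu_eq z.2.2.1 z.2.2.2
      obtain ⟨g, hg, rfl⟩ := exists_idem hU
      exact ⟨g, hg, (oplusEq_iff he hf hg).2 (h.trans hq.symm), ad2Measure_eq_iff.2 hq⟩
    · rintro ⟨g, hg, h, rfl⟩
      exact (oplusEq_iff he hf hg).1 h
  · intro e e' h
    obtain ⟨-, -, hd⟩ := isComplPair_iff.1 h
    rw [dyadicAlg_add_eq_some]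
    change mu (pdom e.1) + mu (pdom e'.1) = 1
    rw [hd, mu_compl (isCylindrical_pdom e)]
    ring

end Coordinatization
end

section
/- Let S be a Boolean inverse monoid in which the relation D preserves complementation. Then S is factorizable: every element of S lies beneath an invertible element in the natural partial order. -/
namespace Coordinatization

namespace IsInverseMonoid

variable {S : Type} {M : InvMonData S} (h : IsInverseMonoid M)
include h

theorem inv_eq_self {e : S} (he : IsIdem M e) : M.inv e = e :=
  (h.inv_unique e e (by rw [he, he]) (by rw [he, he])).symm

theorem inv_inv (a : S) : M.inv (M.inv a) = a :=
  (h.inv_unique _ _ (h.inv_law₂ a) (h.inv_law₁ a)).symm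

theorem isIdem_inv_mul_self (a : S) : IsIdem M (M.mul (M.inv a) a) := by
  rw [IsIdem, ← h.mul_assoc, h.inv_law₂]

theorem isIdem_mul_inv_self (a : S) : IsIdem M (M.mul a (M.inv a)) := by
  rw [IsIdem, ← h.mul_assoc, h.inv_law₁]

theorem isIdem_zero : IsIdem M M.zero := h.zero_mul _

theorem isIdem_mul {e f : S} (he : IsIdem M e) (hf : IsIdem M f) : IsIdem M (M.mul e f) := by
  have h₁ := h.inv_law₁ (M.mul e f)
  have h₂ := h.inv_law₂ (M.mul e f)
  have h₃ := h.inv_inv (M.mul e f)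
  have hu := h.inv_unique (M.mul e f) (M.mul f (M.mul (M.inv (M.mul e f)) e))
  generalize M.inv (M.mul e f) = x at h₁ h₂ h₃ hu
  have he' (a : S) : M.mul e (M.mul e a) = M.mul e a := by rw [← h.mul_assoc, he]
  have hf' (a : S) : M.mul f (M.mul f a) = M.mul f a := by rw [← h.mul_assoc, hf]
  have h₂' (a : S) : M.mul x (M.mul e (M.mul f (M.mul x a))) = M.mul x a := by
    simpa only [h.mul_assoc] using congrArg (M.mul · a) h₂
  simp only [h.mul_assoc] at h₁ hu
  simp only [he', hf', h₂'] at hu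
  have hx := hu h₁ trivial
  have hxx : IsIdem M x := by
    rw [IsIdem, ← hx]
    simp only [h.mul_assoc, h₂']
  rw [← h₃, h.inv_eq_self hxx]
  exact hxx

theorem isIdem_mul_comm {e f : S} (he : IsIdem M e) (hf : IsIdem M f) :
    M.mul e f = M.mul f e := by
  have hef := h.isIdem_mul he hf
  have hfe := h.isIdem_mul hf he
  have he' (a : S) : M.mul e (M.mul e a) = M.mul e a := by rw [← h.mul_assoc, he]
  have hf' (a : S) : M.mul f (M.mul f a) = M.mul f a := by rw [← h.mul_assoc, hf]
  have hu := h.inv_unique (M.mul e f) (M.mul f e)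
  rw [h.inv_eq_self hef] at hu
  simp only [IsIdem, h.mul_assoc] at hef hfe hu
  simp only [he', hf'] at hu
  exact (hu hef hfe).symm

theorem inv_mul_self_nle {s g : S} (hs : nle M s g) :
    nle M (M.mul (M.inv s) s) (M.mul (M.inv g) g) := by
  obtain ⟨k, hk, rfl⟩ := hs
  have hp := h.isIdem_inv_mul_self g
  refine ⟨_, h.isIdem_inv_mul_self (M.mul g k), ?_⟩
  rw [h.isIdem_mul_comm hp (h.isIdem_inv_mul_self _), h.mul_assoc, h.mul_assoc g,
    h.isIdem_mul_comm hk hp, ← h.mul_assoc g, ← h.mul_assoc g, h.inv_law₁]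

theorem mul_inv_self_nle {s g : S} (hs : nle M s g) :
    nle M (M.mul s (M.inv s)) (M.mul g (M.inv g)) := by
  obtain ⟨k, hk, rfl⟩ := hs
  refine ⟨_, h.isIdem_mul_inv_self (M.mul g k), ?_⟩
  rw [← h.mul_assoc, ← h.mul_assoc _ g, h.inv_law₁]

theorem eq_one_of_one_nle {p : S} (hp : IsIdem M p) (h1 : nle M M.one p) : p = M.one := by
  obtain ⟨k, -, hk⟩ := h1
  rw [← h.mul_one p, hk, ← h.mul_assoc, hp]

theorem orthogonal_of_mul_eq_zero {s t : S}
    (hd : M.mul (M.mul (M.inv s) s) (M.mul (M.inv t) t) = M.zero)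
    (hr : M.mul (M.mul s (M.inv s)) (M.mul t (M.inv t)) = M.zero) : Orthogonal M s t := by
  constructor
  · calc M.mul (M.inv s) t
        = M.mul (M.mul (M.mul (M.inv s) s) (M.inv s)) (M.mul (M.mul t (M.inv t)) t) := by
          rw [h.inv_law₁, h.inv_law₂]
      _ = M.mul (M.inv s) (M.mul (M.mul (M.mul s (M.inv s)) (M.mul t (M.inv t))) t) := by
          simp only [h.mul_assoc]
      _ = M.zero := by rw [hr, h.zero_mul, h.mul_zero]
  · calc M.mul s (M.inv t)
        = M.mul (M.mul (M.mul s (M.inv s)) s) (M.mul (M.mul (M.inv t) t) (M.inv t)) := by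
          rw [h.inv_law₁, h.inv_law₂]
      _ = M.mul s (M.mul (M.mul (M.mul (M.inv s) s) (M.mul (M.inv t) t)) (M.inv t)) := by
          simp only [h.mul_assoc]
      _ = M.zero := by rw [hd, h.zero_mul, h.mul_zero]

theorem compatible_of_orthogonal {s t : S} (hst : Orthogonal M s t) : Compatible M s t := by
  rw [Compatible, hst.1, hst.2]
  exact ⟨h.isIdem_zero, h.isIdem_zero⟩

end IsInverseMonoid

/-- A Boolean inverse monoid in which `D` preserves complementation is factorizable:
every element lies beneath an invertible element in the natural partial order. -/
theorem factorizable_of_dpc {S : Type} (M : InvMonData S)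
    (hB : IsBooleanInverseMonoid M) (hD : DPreservesCompl M) :
    Factorizable M := by
  intro s
  have h := hB.invMon
  obtain ⟨e, he⟩ := hB.compl_exists _ (h.isIdem_inv_mul_self s)
  obtain ⟨f, hf⟩ := hB.compl_exists _ (h.isIdem_mul_inv_self s)
  obtain ⟨t, rfl, rfl⟩ := hD _ _ e f ⟨s, rfl, rfl⟩ he hf
  obtain ⟨-, -, hd, -, -, hd_least⟩ := he
  obtain ⟨-, -, hr, -, -, hr_least⟩ := hf
  obtain ⟨g, hsg, htg, -⟩ := hB.joins_exist s t
    (h.compatible_of_orthogonal (h.orthogonal_of_mul_eq_zero hd hr))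
  exact ⟨g,
    h.eq_one_of_one_nle (h.isIdem_mul_inv_self g)
      (hr_least _ (h.mul_inv_self_nle hsg) (h.mul_inv_self_nle htg)),
    h.eq_one_of_one_nle (h.isIdem_inv_mul_self g)
      (hd_least _ (h.inv_mul_self_nle hsg) (h.inv_mul_self_nle htg)), hsg⟩

end Coordinatization
end

section
/- Let S be a Boolean inverse monoid equipped with a good invariant mean μ that reflects the D-relation. Then S is completely semisimple, the relation D preserves complementation, and S/J is linearly ordered (in particular S satisfies the lattice condition). -/
namespace Coordinatization

/-- In an inverse monoid, products of idempotents are idempotent. -/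
theorem IsIdem.mul {M : InvMonData S} (hM : IsInverseMonoid M) {e f : S}
    (he : IsIdem M e) (hf : IsIdem M f) : IsIdem M (M.mul e f) := by
  unfold IsIdem at *
  have assoc := hM.mul_assoc
  have he' : ∀ z, M.mul e (M.mul e z) = M.mul e z := fun z => by rw [← assoc, he]
  have hf' : ∀ z, M.mul f (M.mul f z) = M.mul f z := fun z => by rw [← assoc, hf]
  have h₁ := hM.inv_law₁ (M.mul e f)
  have h₂ := hM.inv_law₂ (M.mul e f)
  have hu := hM.inv_unique (M.mul e f)
  generalize M.inv (M.mul e f) = x at h₁ h₂ hu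
  have h₂' : ∀ z, M.mul x (M.mul e (M.mul f (M.mul x z))) = M.mul x z := fun z => by
    simpa only [assoc] using congrArg (fun w => M.mul w z) h₂
  have hx : M.mul (M.mul f x) e = x := by
    apply hu
    · simpa only [assoc, he', hf'] using h₁
    · simp only [assoc, he', hf', h₂']
  have hxx : M.mul x x = x := by
    rw [← hx]
    simp only [assoc, h₂']
  have h₃ : M.mul e f = x := by
    rw [hM.inv_unique x _ h₂ h₁]
    exact (hM.inv_unique x x (by rw [hxx, hxx]) (by rw [hxx, hxx])).symm
  rw [h₃, hxx]

/-- In an inverse monoid, idempotents commute. -/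
theorem IsIdem.mul_comm {M : InvMonData S} (hM : IsInverseMonoid M) {e f : S}
    (he : IsIdem M e) (hf : IsIdem M f) : M.mul e f = M.mul f e := by
  have hef := he.mul hM hf
  have hfe := hf.mul hM he
  unfold IsIdem at *
  have assoc := hM.mul_assoc
  have he' : ∀ z, M.mul e (M.mul e z) = M.mul e z := fun z => by rw [← assoc, he]
  have hf' : ∀ z, M.mul f (M.mul f z) = M.mul f z := fun z => by rw [← assoc, hf]
  have h : M.mul f e = M.inv (M.mul e f) := by
    apply hM.inv_unique
    · simpa only [assoc, he', hf'] using hef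
    · simpa only [assoc, he', hf'] using hfe
  rw [h]
  exact hM.inv_unique _ _ (by rw [hef, hef]) (by rw [hef, hef])

theorem isIdem_inv_mul_self_s9 {M : InvMonData S} (hM : IsInverseMonoid M) (s : S) :
    IsIdem M (M.mul (M.inv s) s) := by
  unfold IsIdem
  rw [← hM.mul_assoc, hM.inv_law₂]

theorem isIdem_zero {M : InvMonData S} (hM : IsInverseMonoid M) : IsIdem M M.zero :=
  hM.zero_mul _

theorem nle_refl {M : InvMonData S} (hM : IsInverseMonoid M) (a : S) : nle M a a :=
  ⟨M.one, hM.one_mul _, (hM.mul_one a).symm⟩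

theorem zero_nle {M : InvMonData S} (hM : IsInverseMonoid M) (a : S) : nle M M.zero a :=
  ⟨M.zero, isIdem_zero hM, (hM.mul_zero a).symm⟩

theorem IsIdem.mul_eq_of_nle {M : InvMonData S} (hM : IsInverseMonoid M) {e f : S}
    (he : IsIdem M e) (h : nle M f e) : M.mul e f = f := by
  obtain ⟨x, -, rfl⟩ := h
  rw [← hM.mul_assoc, he]

theorem eq_zero_of_dRel_zero {M : InvMonData S} (hM : IsInverseMonoid M) {e : S}
    (h : DRel M e M.zero) : e = M.zero := by
  obtain ⟨a, rfl, ha⟩ := h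
  have : a = M.zero := by rw [← hM.inv_law₁ a, ha, hM.zero_mul]
  rw [this, hM.mul_zero]

theorem Jle.refl {M : InvMonData S} (hM : IsInverseMonoid M) (s : S) : Jle M s s :=
  ⟨M.one, M.one, by rw [hM.one_mul, hM.mul_one]⟩

/-- If the domain idempotent of `s` is `D`-related to an idempotent below that of `t`, then
`s` lies in the principal ideal generated by `t`. -/
theorem jle_of_dRel_nle {M : InvMonData S} (hM : IsInverseMonoid M) {s t e : S}
    (hD : DRel M (M.mul (M.inv s) s) e) (hle : nle M e (M.mul (M.inv t) t)) : Jle M s t := by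
  obtain ⟨a, ha₁, ha₂⟩ := hD
  obtain ⟨x, -, rfl⟩ := hle
  refine ⟨M.mul s (M.mul (M.inv a) (M.inv t)), M.mul x a, ?_⟩
  calc s = M.mul s (M.mul (M.inv s) s) := by rw [← hM.mul_assoc, hM.inv_law₁]
    _ = M.mul s (M.mul (M.inv a) (M.mul (M.mul a (M.inv a)) a)) := by rw [hM.inv_law₁, ha₁]
    _ = _ := by rw [ha₂]; simp only [hM.mul_assoc]

theorem latticeCondition_of_jle_total {M : InvMonData S} (hM : IsInverseMonoid M)
    (h : ∀ s t : S, Jle M s t ∨ Jle M t s) : LatticeCondition M := by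
  intro s t
  rcases h s t with h | h
  · exact ⟨⟨s, .refl hM s, h, fun _ hs _ => hs⟩, ⟨t, h, .refl hM t, fun _ _ ht => ht⟩⟩
  · exact ⟨⟨t, h, .refl hM t, fun _ _ ht => ht⟩, ⟨s, .refl hM s, h, fun _ hs _ => hs⟩⟩

/-- Let `S` be a Boolean inverse monoid equipped with a good invariant mean `μ` that
reflects the `D`-relation.  Then `S` is completely semisimple, `D` preserves
complementation, and `S/J` is linearly ordered (so `S` satisfies the lattice condition). -/
theorem invariant_mean_consequences {S : Type} (M : InvMonData S)
    (hB : IsBooleanInverseMonoid M) (μ : S → ℝ)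
    -- μ takes values in [0,1] on idempotents
    (hrange : ∀ e, IsIdem M e → 0 ≤ μ e ∧ μ e ≤ 1)
    -- (IM1)
    (hone : μ M.one = 1)
    -- (IM2)
    (hinv : ∀ s, μ (M.mul (M.inv s) s) = μ (M.mul s (M.inv s)))
    -- (IM3)
    (hadd : ∀ e f j, IsIdem M e → IsIdem M f → M.mul e f = M.zero →
      IsJoin M e f j → μ j = μ e + μ f)
    -- μ is good
    (hgood : ∀ e f, IsIdem M e → IsIdem M f → μ e ≤ μ f →
      ∃ e', IsIdem M e' ∧ nle M e' f ∧ μ e' = μ e)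
    -- μ reflects the D-relation
    (hrefl : ∀ e f, IsIdem M e → IsIdem M f → μ e = μ f → DRel M e f) :
    CompletelySemisimple M ∧ DPreservesCompl M ∧
      (∀ s t : S, Jle M s t ∨ Jle M t s) ∧ LatticeCondition M := by
  have hM := hB.invMon
  have hD : ∀ {e f}, DRel M e f → μ e = μ f := by
    rintro _ _ ⟨a, rfl, rfl⟩
    exact hinv a
  have h0 : μ M.zero = 0 := by
    have := hadd M.zero M.zero M.zero (isIdem_zero hM) (isIdem_zero hM) (hM.zero_mul _)
      ⟨nle_refl hM _, nle_refl hM _, fun _ h _ => h⟩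
    linarith
  have hJ : ∀ s t, μ (M.mul (M.inv s) s) ≤ μ (M.mul (M.inv t) t) → Jle M s t := by
    intro s t h
    obtain ⟨e, he, hle, heq⟩ :=
      hgood _ _ (isIdem_inv_mul_self_s9 hM s) (isIdem_inv_mul_self_s9 hM t) h
    exact jle_of_dRel_nle hM (hrefl _ _ (isIdem_inv_mul_self_s9 hM s) he heq.symm) hle
  have htotal : ∀ s t, Jle M s t ∨ Jle M t s := fun s t =>
    (le_total _ _).imp (hJ s t) (hJ t s)
  refine ⟨?_, ?_, htotal, latticeCondition_of_jle_total hM htotal⟩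
  · intro e f he hf hef hle
    obtain ⟨f', -, hf', hff', hj⟩ := hB.compl_exists f hf
    have hg := he.mul hM hf'
    have heqf := he.mul_eq_of_nle hM hle
    have hj' := hB.mul_join_left e _ _ _ hj
    rw [heqf, hM.mul_one] at hj'
    have horth : M.mul f (M.mul e f') = M.zero := by
      rw [he.mul_comm hM hf', ← hM.mul_assoc, hff', hM.zero_mul]
    have hμ := hadd _ _ _ hf hg horth hj'
    have hzero : M.mul e f' = M.zero :=
      eq_zero_of_dRel_zero hM (hrefl _ _ hg (isIdem_zero hM) (by linarith [hD hef]))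
    rw [hzero] at hj'
    have hfe := hf.mul_eq_of_nle hM (hj'.2.2 f (nle_refl hM f) (zero_nle hM f))
    rw [← hfe, hf.mul_comm hM he, heqf]
  · rintro e f e' f' hef ⟨he, he', hee', hje⟩ ⟨hf, hf', hff', hjf⟩
    apply hrefl _ _ he' hf'
    linarith [hadd _ _ _ he he' hee' hje, hadd _ _ _ hf hf' hff' hjf, hD hef]

end Coordinatization
end
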